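/- Let X be a p-normed space (0 < p ≤ 1). There is a constant χ_p = 2^{1/p - 1}(2^p - 1)^{-1/p} such that for any finite sequence (x_k) in X and any real numbers (α_k), one has ‖∑ α_k r_k x_k‖_{L_p(X)} ≤ χ_p (sup_k |α_k|) ‖∑ r_k x_k‖_{L_p(X)}, where (r_k) are the Rademacher functions and ‖f‖_{L_p(X)} = (∫ ‖f(t)‖^p dt)^{1/p}. -/

import Mathlib

/-- The real sign associated to a boolean: `true ↦ 1`, `false ↦ -1`. -/
def radSign (b : Bool) : ℝ := if b then 1 else -1

lemma radSign_beq (a b : Bool) : radSign (a == b) = radSign b * radSign a := by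
  cases a <;> cases b <;> simp [radSign]

lemma rad_sign_flip {X : Type*} [AddCommGroup X] [Module ℝ X] (p : ℝ) (N : X → ℝ)
    (n : ℕ) (x : Fin n → X) (e : Fin n → Bool) :
    ∑ s : Fin n → Bool, N (∑ k, (radSign (e k) * radSign (s k)) • x k) ^ p =
      ∑ s : Fin n → Bool, N (∑ k, radSign (s k) • x k) ^ p := by
  have hinv : Function.Involutive (fun (s : Fin n → Bool) (k : Fin n) => (s k == e k)) := by
    intro s
    funext k
    simp only
    cases s k <;> cases e k <;> rfl
  rw [← Equiv.sum_comp hinv.toPerm (fun s : Fin n → Bool => N (∑ k, radSign (s k) • x k) ^ p)]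
  refine Finset.sum_congr rfl fun s _ => ?_
  simp [Function.Involutive.toPerm, radSign_beq]

lemma rad_main {X : Type*} [AddCommGroup X] [Module ℝ X]
    (p : ℝ) (hp0 : 0 < p)
    (N : X → ℝ)
    (hN0 : ∀ x, 0 ≤ N x)
    (hNsmul : ∀ (c : ℝ) (x : X), N (c • x) = |c| * N x)
    (hNp : ∀ x y : X, N (x + y) ^ p ≤ N x ^ p + N y ^ p)
    (n : ℕ) (x : Fin n → X) (A : ℝ) (hA : 0 ≤ A) (α : Fin n → ℝ)
    (hα : ∀ k, |α k| ≤ A) :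
    (∑ s : Fin n → Bool, N (∑ k, (α k * radSign (s k)) • x k) ^ p) ≤
      A ^ p * (∑ s : Fin n → Bool, N (∑ k, radSign (s k) • x k) ^ p) / ((2 : ℝ) ^ p - 1) := by
  set F : (Fin n → ℝ) → ℝ := fun α =>
    ∑ s : Fin n → Bool, N (∑ k, (α k * radSign (s k)) • x k) ^ p with hF
  set F1 := ∑ s : Fin n → Bool, N (∑ k, radSign (s k) • x k) ^ p with hF1
  have habs : ∀ b, |radSign b| = 1 := by intro b; cases b <;> simp [radSign]
  have hz : N 0 ^ p = 0 := by
    have := hNsmul 0 0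
    simp at this
    rw [this, Real.zero_rpow hp0.ne']
  have h2p : 1 < (2 : ℝ) ^ p := Real.one_lt_rpow (by norm_num) hp0
  have hstep : ∀ a : Fin n → ℝ, (∀ k, |a k| ≤ A) → ∃ b : Fin n → ℝ, (∀ k, |b k| ≤ A) ∧
      (2 : ℝ) ^ p * F a ≤ A ^ p * F1 + F b := by
    intro a ha
    set e : Fin n → Bool := fun k => decide (0 ≤ a k) with he
    refine ⟨fun k => 2 * a k - A * radSign (e k), ?_, ?_⟩
    · intro k
      have := abs_le.1 (ha k)
      by_cases h : 0 ≤ a k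
      · simp only [he, radSign, h, decide_true, if_true]
        rw [abs_le]; constructor <;> linarith
      · simp only [he, radSign, h, decide_false]
        rw [abs_le]; push Not at h; constructor <;> norm_num <;> linarith
    · rw [hF1, ← rad_sign_flip p N n x e, Finset.mul_sum, hF]
      simp only
      rw [Finset.mul_sum, ← Finset.sum_add_distrib]
      refine Finset.sum_le_sum fun s _ => ?_
      rw [← Real.mul_rpow (by norm_num) (hN0 _), ← Real.mul_rpow hA (hN0 _)]
      have h1 := hNsmul 2 (∑ k, (a k * radSign (s k)) • x k)
      have h2 := hNsmul A (∑ k, (radSign (e k) * radSign (s k)) • x k)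
      rw [abs_of_nonneg hA] at h2
      rw [abs_of_nonneg (by norm_num)] at h1
      rw [← h1, ← h2]
      refine le_trans (le_of_eq ?_) (hNp _ _)
      congr 2
      rw [Finset.smul_sum, Finset.smul_sum, ← Finset.sum_add_distrib]
      refine Finset.sum_congr rfl fun k _ => ?_
      rw [smul_smul, smul_smul, ← add_smul]
      congr 1
      ring
  set T : Set ℝ := F '' {a | ∀ k, |a k| ≤ A} with hT
  have hbdd : BddAbove T := by
    refine ⟨∑ s : Fin n → Bool, ∑ k, (A * N (x k)) ^ p, ?_⟩
    rintro _ ⟨a, ha, rfl⟩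
    refine Finset.sum_le_sum fun s _ => ?_
    refine le_trans (Finset.le_sum_of_subadditive (fun y => N y ^ p) hz.le hNp _ _) ?_
    refine Finset.sum_le_sum fun k _ => ?_
    rw [hNsmul, abs_mul, habs, mul_one]
    exact Real.rpow_le_rpow (mul_nonneg (abs_nonneg _) (hN0 _))
      (mul_le_mul_of_nonneg_right (ha k) (hN0 _)) hp0.le
  have hle : ∀ a : Fin n → ℝ, (∀ k, |a k| ≤ A) → F a ≤ sSup T :=
    fun a ha => le_csSup hbdd ⟨a, ha, rfl⟩
  have hS : sSup T ≤ (A ^ p * F1 + sSup T) / (2 : ℝ) ^ p := by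
    refine csSup_le ⟨_, α, hα, rfl⟩ ?_
    rintro _ ⟨a, ha, rfl⟩
    obtain ⟨b, hb, hab⟩ := hstep a ha
    rw [le_div_iff₀ (by linarith)]
    linarith [hle b hb]
  rw [le_div_iff₀ (by linarith)] at hS
  refine (hle α hα).trans ?_
  rw [le_div_iff₀ (by linarith)]
  linarith

/-- Proposition 3.5: in a `p`-normed space (`0 < p ≤ 1`), with
`χ_p = 2^(1/p - 1) (2^p - 1)^(-1/p)`, for any finite sequence `(x k)` and any real
coefficients `α k` with `|α k| ≤ A`, one has
`‖∑ α_k r_k x_k‖_{L_p(X)} ≤ χ_p · A · ‖∑ r_k x_k‖_{L_p(X)}`, where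
`‖f‖_{L_p(X)} = (E ‖f‖^p)^{1/p}` and the expectation is over uniform signs `r_k = ±1`. -/
theorem pnormed_unconditionality
    {X : Type*} [AddCommGroup X] [Module ℝ X]
    (p : ℝ) (hp0 : 0 < p) (hp1 : p ≤ 1)
    (N : X → ℝ)
    (hN0 : ∀ x, 0 ≤ N x)
    (hNsmul : ∀ (c : ℝ) (x : X), N (c • x) = |c| * N x)
    (hNp : ∀ x y : X, N (x + y) ^ p ≤ N x ^ p + N y ^ p)
    (n : ℕ) (x : Fin n → X) (α : Fin n → ℝ) (A : ℝ) (hA : 0 ≤ A)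
    (hα : ∀ k, |α k| ≤ A) :
    ((∑ s : Fin n → Bool, N (∑ k, (α k * radSign (s k)) • x k) ^ p) / 2 ^ n) ^ (1 / p) ≤
      ((2 : ℝ) ^ (1 / p - 1) * ((2 : ℝ) ^ p - 1) ^ (-(1 / p))) * A *
        ((∑ s : Fin n → Bool, N (∑ k, radSign (s k) • x k) ^ p) / 2 ^ n) ^ (1 / p) := by
  have h2p : 1 < (2 : ℝ) ^ p := Real.one_lt_rpow (by norm_num) hp0
  have hmain := rad_main p hp0 N hN0 hNsmul hNp n x A hA α hα
  set F1 := ∑ s : Fin n → Bool, N (∑ k, radSign (s k) • x k) ^ p with hF1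
  have hF1n : 0 ≤ F1 := Finset.sum_nonneg fun s _ => Real.rpow_nonneg (hN0 _) _
  have hL : 0 ≤ ∑ s : Fin n → Bool, N (∑ k, (α k * radSign (s k)) • x k) ^ p :=
    Finset.sum_nonneg fun s _ => Real.rpow_nonneg (hN0 _) _
  have hD : 0 < (2 : ℝ) ^ p - 1 := by linarith
  have h1 : (1 : ℝ) ≤ 2 ^ (1 / p - 1) := by
    refine Real.one_le_rpow (by norm_num) ?_
    have := (one_le_div hp0).2 hp1
    linarith
  have hB : 0 ≤ F1 / 2 ^ n := by positivity
  calc _ ≤ (((2 : ℝ) ^ p - 1)⁻¹ * A ^ p * (F1 / 2 ^ n)) ^ (1 / p) := by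
        refine Real.rpow_le_rpow (by positivity) ?_ (by positivity)
        refine (div_le_div_of_nonneg_right hmain (by positivity)).trans (le_of_eq ?_)
        field_simp
    _ = 1 * (((2 : ℝ) ^ p - 1) ^ (-(1 / p)) * A * (F1 / 2 ^ n) ^ (1 / p)) := by
        rw [Real.mul_rpow (by positivity) hB, Real.mul_rpow (by positivity) (by positivity),
          ← Real.rpow_mul hA, mul_one_div_cancel hp0.ne', Real.rpow_one,
          Real.inv_rpow hD.le, Real.rpow_neg hD.le, one_mul]
    _ ≤ 2 ^ (1 / p - 1) * (((2 : ℝ) ^ p - 1) ^ (-(1 / p)) * A * (F1 / 2 ^ n) ^ (1 / p)) :=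
        mul_le_mul_of_nonneg_right h1 (by positivity)
    _ = _ := by ring
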